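/- Quantum discord is nonnegative: for any bipartite density matrix ρ^{AB}, D(A⟩B) = S(A:B)_ρ − sup over POVMs {F_j} on B of [S(ρ^A) − Σ_j β_j S(ρ^A_j)] ≥ 0, where β_j and ρ^A_j are the probability and conditional state of A given outcome j on B. -/

import Mathlib

open Matrix Kronecker
open scoped BigOperators ComplexOrder

/-- Von Neumann entropy (base 2) of a Hermitian matrix, via its eigenvalues. -/
noncomputable def vNEntropy {d : Type*} [Fintype d] [DecidableEq d]
    {ρ : Matrix d d ℂ} (h : ρ.IsHermitian) : ℝ :=
  -∑ i, h.eigenvalues i * Real.logb 2 (h.eigenvalues i)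

/-- Partial trace over the second (B) factor. -/
noncomputable def ptraceB {da db : Type*} [Fintype db]
    (ρ : Matrix (da × db) (da × db) ℂ) : Matrix da da ℂ :=
  fun i i' => ∑ j, ρ (i, j) (i', j)

/-- Partial trace over the first (A) factor. -/
noncomputable def ptraceA {da db : Type*} [Fintype da]
    (ρ : Matrix (da × db) (da × db) ℂ) : Matrix db db ℂ :=
  fun j j' => ∑ i, ρ (i, j) (i, j')

open Filter Topology in
/-- If `∑ p = 0` and `s ↦ ∑ p log (μ + s λ)` has nonnegative derivative on `(0, ∞)`, then comparing
its values at `0` and at `∞` gives `∑ p log μ ≤ ∑ p log λ`. -/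
lemma sum_mul_log_le_of_resolvent_nonneg {ι : Type*} [Fintype ι] (p mu lam : ι → ℝ)
    (hmu : ∀ i, p i ≠ 0 → 0 < mu i) (hlam : ∀ i, p i ≠ 0 → 0 < lam i) (hp : ∑ i, p i = 0)
    (h : ∀ s : ℝ, 0 < s → 0 ≤ ∑ i, p i * (lam i / (mu i + s * lam i))) :
    ∑ i, p i * Real.log (mu i) ≤ ∑ i, p i * Real.log (lam i) := by
  have hder : ∀ s : ℝ, 0 ≤ s → HasDerivAt (fun s => ∑ i, p i * Real.log (mu i + s * lam i))
      (∑ i, p i * (lam i / (mu i + s * lam i))) s := by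
    intro s hs
    refine HasDerivAt.fun_sum fun i _ => ?_
    by_cases hi : p i = 0
    · simpa [hi] using hasDerivAt_const s (0 : ℝ)
    · have hpos : 0 < mu i + s * lam i := by
        have := mul_nonneg hs (hlam i hi).le
        linarith [hmu i hi]
      refine HasDerivAt.const_mul _ (HasDerivAt.log ?_ hpos.ne')
      simpa using ((hasDerivAt_id s).mul_const (lam i)).const_add (mu i)
  have hmono : MonotoneOn (fun s => ∑ i, p i * Real.log (mu i + s * lam i)) (Set.Ici 0) := by
    refine monotoneOn_of_deriv_nonneg (convex_Ici 0)
      (fun s hs => (hder s hs).continuousAt.continuousWithinAt) ?_ ?_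
    · rw [interior_Ici]
      exact fun s hs => (hder s (le_of_lt hs)).differentiableAt.differentiableWithinAt
    · rw [interior_Ici]
      intro s hs
      rw [(hder s (le_of_lt hs)).deriv]
      exact h s hs
  have hlim : Tendsto (fun s => ∑ i, p i * Real.log (mu i / s + lam i)) atTop
      (𝓝 (∑ i, p i * Real.log (lam i))) := by
    refine tendsto_finsetSum _ fun i _ => ?_
    by_cases hi : p i = 0
    · simp [hi]
    · refine Tendsto.const_mul _ (Tendsto.log ?_ (hlam i hi).ne')
      simpa using (tendsto_const_nhds.div_atTop tendsto_id).add_const (lam i)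
  refine ge_of_tendsto hlim ((eventually_gt_atTop 0).mono fun s hs => ?_)
  have h0 := hmono Set.self_mem_Ici (Set.mem_Ici.2 hs.le) hs.le
  have hshift : ∑ i, p i * Real.log (mu i + s * lam i)
      = ∑ i, p i * Real.log (mu i / s + lam i) := by
    have : ∀ i, p i * Real.log (mu i + s * lam i)
        = p i * Real.log (mu i / s + lam i) + p i * Real.log s := by
      intro i
      by_cases hi : p i = 0
      · simp [hi]
      · have hpos : 0 < mu i / s + lam i := add_pos (div_pos (hmu i hi) hs) (hlam i hi)
        rw [← mul_add, ← Real.log_mul hpos.ne' hs.ne']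
        congr 2
        field_simp
    simp_rw [this, Finset.sum_add_distrib, ← Finset.sum_mul, hp]
    simp
  simpa [← hshift] using h0

section Spectral

variable {n : Type*} [Fintype n] [DecidableEq n]

lemma Matrix.IsHermitian.eq_eigenvectorUnitary_mul_diagonal {A : Matrix n n ℂ}
    (hA : A.IsHermitian) :
    A = (hA.eigenvectorUnitary : Matrix n n ℂ) * diagonal (fun i => (hA.eigenvalues i : ℂ)) *
      (hA.eigenvectorUnitary : Matrix n n ℂ)ᴴ := by
  conv_lhs => rw [hA.spectral_theorem]
  rfl

lemma two_mul_re_conj_mul_sub_le (x c : ℂ) {l m s : ℝ} (hl : 0 ≤ l) (hm : 0 ≤ m) (hs : 0 < s) :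
    2 * (star x * c * l).re - m * ‖x‖ ^ 2 - s * l * ‖x‖ ^ 2
      ≤ ‖c‖ ^ 2 * l * (l / (m + s * l)) := by
  rcases hl.eq_or_lt with rfl | hl
  · simp only [Complex.ofReal_zero, mul_zero, Complex.zero_re, zero_mul, sub_zero, zero_sub,
      zero_div]
    nlinarith [mul_nonneg hm (sq_nonneg ‖x‖)]
  have hd : 0 < m + s * l := by positivity
  have hre : (star x * c * l).re ≤ ‖x‖ * ‖c‖ * l := by
    refine (Complex.re_le_norm _).trans_eq ?_
    simp [abs_of_pos hl]
  have hsq : 0 ≤ ((m + s * l) * ‖x‖ - ‖c‖ * l) ^ 2 / (m + s * l) := by positivity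
  have hexp : ((m + s * l) * ‖x‖ - ‖c‖ * l) ^ 2 / (m + s * l)
      = (m + s * l) * ‖x‖ ^ 2 - 2 * (‖x‖ * ‖c‖ * l) + ‖c‖ ^ 2 * l * (l / (m + s * l)) := by
    field_simp
    ring
  linarith

lemma re_trace_conjTranspose_mul_diagonal_mul (Z : Matrix n n ℂ) (d : n → ℝ) :
    (Zᴴ * diagonal (fun k => (d k : ℂ)) * Z).trace.re = ∑ k, ∑ i, d k * ‖Z k i‖ ^ 2 := by
  rw [Finset.sum_comm, trace, Complex.re_sum]
  refine Finset.sum_congr rfl fun i _ => ?_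
  rw [diag_apply, mul_apply, Complex.re_sum]
  refine Finset.sum_congr rfl fun k _ => ?_
  rw [mul_diagonal, conjTranspose_apply, mul_right_comm, RCLike.star_def,
    ← Complex.normSq_eq_conj_mul_self, ← Complex.ofReal_mul, Complex.ofReal_re,
    Complex.normSq_eq_norm_sq, mul_comm]

/-- The quadratic form `X ↦ 2 Re tr (Xᴴ ρ) - tr (Xᴴ σ X) - s tr (X ρ Xᴴ)` is bounded by its maximum,
the `s`-resolvent of the relative modular operator of `σ = V μ Vᴴ` and `ρ = U λ Uᴴ`. -/
lemma two_mul_re_trace_sub_le (U V X : Matrix n n ℂ) (hU : Uᴴ * U = 1) (hV : Vᴴ * V = 1)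
    (lam mu : n → ℝ) (hlam : ∀ i, 0 ≤ lam i) (hmu : ∀ i, 0 ≤ mu i) {s : ℝ} (hs : 0 < s) :
    2 * (Xᴴ * (U * diagonal (fun i => (lam i : ℂ)) * Uᴴ)).trace.re
        - (Xᴴ * (V * diagonal (fun i => (mu i : ℂ)) * Vᴴ) * X).trace.re
        - s * (X * (U * diagonal (fun i => (lam i : ℂ)) * Uᴴ) * Xᴴ).trace.re
      ≤ ∑ k, ∑ i, ‖(Vᴴ * U) k i‖ ^ 2 * lam i * (lam i / (mu k + s * lam i)) := by
  have hU' : U * Uᴴ = 1 := mul_eq_one_comm.mp hU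
  have hV' : V * Vᴴ = 1 := mul_eq_one_comm.mp hV
  set Z := Vᴴ * X * U with hZ
  have hZc : Zᴴ = Uᴴ * Xᴴ * V := by simp [hZ, Matrix.mul_assoc]
  set L := diagonal (fun i => (lam i : ℂ))
  set M := diagonal (fun i => (mu i : ℂ))
  have e1 : (Xᴴ * (U * L * Uᴴ)).trace = (Zᴴ * (Vᴴ * U) * L).trace := by
    calc (Xᴴ * (U * L * Uᴴ)).trace = (Uᴴ * (Xᴴ * (U * L))).trace := by
          rw [← Matrix.mul_assoc, trace_mul_comm]
      _ = (Uᴴ * Xᴴ * (V * Vᴴ) * U * L).trace := by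
          rw [hV']; simp only [Matrix.mul_assoc, Matrix.mul_one]
      _ = _ := by rw [hZc]; simp only [Matrix.mul_assoc]
  have e2 : (Xᴴ * (V * M * Vᴴ) * X).trace = (Zᴴ * M * Z).trace := by
    calc (Xᴴ * (V * M * Vᴴ) * X).trace = (Xᴴ * (V * M * Vᴴ) * X * (U * Uᴴ)).trace := by
          rw [hU', Matrix.mul_one]
      _ = (Uᴴ * (Xᴴ * (V * M * Vᴴ) * X * U)).trace := by
          rw [← Matrix.mul_assoc, trace_mul_comm]
      _ = _ := by rw [hZc, hZ]; simp only [Matrix.mul_assoc]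
  have e3 : (X * (U * L * Uᴴ) * Xᴴ).trace = (Zᴴᴴ * L * Zᴴ).trace := by
    calc (X * (U * L * Uᴴ) * Xᴴ).trace = (X * (U * L * Uᴴ) * Xᴴ * (V * Vᴴ)).trace := by
          rw [hV', Matrix.mul_one]
      _ = (Vᴴ * (X * (U * L * Uᴴ) * Xᴴ * V)).trace := by
          rw [← Matrix.mul_assoc, trace_mul_comm]
      _ = _ := by
          rw [conjTranspose_conjTranspose, hZc, hZ]
          simp only [Matrix.mul_assoc]
  have e1' : (Zᴴ * (Vᴴ * U) * L).trace.re
      = ∑ k, ∑ i, (star (Z k i) * (Vᴴ * U) k i * (lam i : ℂ)).re := by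
    rw [Finset.sum_comm, trace, Complex.re_sum]
    refine Finset.sum_congr rfl fun i _ => ?_
    rw [diag_apply, mul_diagonal, mul_apply, Finset.sum_mul, Complex.re_sum]
    rfl
  rw [e1, e2, e3, e1', re_trace_conjTranspose_mul_diagonal_mul,
    re_trace_conjTranspose_mul_diagonal_mul, Finset.sum_comm (f := fun k i => lam k * _)]
  simp_rw [Finset.mul_sum, ← Finset.sum_sub_distrib]
  refine Finset.sum_le_sum fun k _ => Finset.sum_le_sum fun i _ => ?_
  rw [conjTranspose_apply, norm_star, ← mul_assoc s]
  exact two_mul_re_conj_mul_sub_le _ _ (hlam i) (hmu k) hs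

end Spectral

section PartialTrace

variable {m n ι : Type*}

lemma trace_mul_kronecker_one [Fintype m] [Fintype n] [DecidableEq n]
    (M : Matrix (m × n) (m × n) ℂ) (Y : Matrix m m ℂ) :
    (M * (Y ⊗ₖ (1 : Matrix n n ℂ))).trace = (ptraceB M * Y).trace := by
  simp only [trace, diag_apply, mul_apply, kroneckerMap_apply, ptraceB, Fintype.sum_prod_type,
    one_apply, mul_ite, mul_one, mul_zero, Finset.sum_ite_eq', Finset.mem_univ, if_true,
    Finset.sum_mul]
  exact Finset.sum_congr rfl fun i _ => Finset.sum_comm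

lemma trace_mul_one_kronecker [Fintype m] [Fintype n] [DecidableEq m]
    (M : Matrix (m × n) (m × n) ℂ) (Z : Matrix n n ℂ) :
    (M * ((1 : Matrix m m ℂ) ⊗ₖ Z)).trace = (ptraceA M * Z).trace := by
  simp only [trace, diag_apply, mul_apply, kroneckerMap_apply, ptraceA, Fintype.sum_prod_type,
    one_apply, ite_mul, one_mul, zero_mul, mul_ite, mul_zero, Finset.sum_mul]
  rw [Finset.sum_comm]
  refine Finset.sum_congr rfl fun j _ => ?_
  rw [Finset.sum_comm' (t' := Finset.univ) (s' := fun _ => Finset.univ) (by simp)]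
  simp [Finset.sum_comm (s := (Finset.univ : Finset m)) (t := (Finset.univ : Finset n))]

lemma trace_ptraceB [Fintype m] [Fintype n] (M : Matrix (m × n) (m × n) ℂ) :
    (ptraceB M).trace = M.trace := by
  simp [trace, ptraceB, Fintype.sum_prod_type]

lemma Matrix.PosSemidef.ptraceB [Fintype n] {M : Matrix (m × n) (m × n) ℂ}
    (hM : M.PosSemidef) :
    (ptraceB M).PosSemidef := by
  have : _root_.ptraceB M = ∑ j, M.submatrix (fun i => (i, j)) (fun i => (i, j)) := by
    ext i i'
    simp [_root_.ptraceB, Matrix.sum_apply]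
  rw [this]
  exact posSemidef_sum _ fun j _ => hM.submatrix _

/-- A measurement on `B` leaves a positive semidefinite unnormalised state on `A`. -/
lemma posSemidef_ptraceB_mul_one_kronecker [Fintype m] [Fintype n] [DecidableEq m]
    {ρ : Matrix (m × n) (m × n) ℂ} (hρ : ρ.PosSemidef)
    (F : Matrix n n ℂ) :
    (ptraceB (ρ * ((1 : Matrix m m ℂ) ⊗ₖ (Fᴴ * F)))).PosSemidef := by
  have hK : ((1 : Matrix m m ℂ) ⊗ₖ (Fᴴ * F)) = ((1 : Matrix m m ℂ) ⊗ₖ F)ᴴ * (1 ⊗ₖ F) := by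
    rw [conjTranspose_kronecker, ← mul_kronecker_mul, conjTranspose_one, Matrix.one_mul]
  have hcyc : ∀ M : Matrix (m × n) (m × n) ℂ,
      ptraceB (M * ((1 : Matrix m m ℂ) ⊗ₖ F)) = ptraceB (((1 : Matrix m m ℂ) ⊗ₖ F) * M) := by
    intro M
    ext i i'
    simp only [ptraceB, mul_apply, kroneckerMap_apply, Fintype.sum_prod_type, one_apply, ite_mul,
      one_mul, zero_mul, mul_ite, mul_zero]
    have h1 : ∀ x, ∑ x_1, ∑ x_2, (if x_1 = i' then M (i, x) (x_1, x_2) * F x_2 x else 0)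
        = ∑ x_2, M (i, x) (i', x_2) * F x_2 x := fun x => by rw [Finset.sum_comm]; simp
    have h2 : ∀ x, ∑ x_1, ∑ x_2, (if i = x_1 then F x x_2 * M (x_1, x_2) (i', x) else 0)
        = ∑ x_2, F x x_2 * M (i, x_2) (i', x) := fun x => by rw [Finset.sum_comm]; simp
    simp_rw [h1, h2]
    rw [Finset.sum_comm]
    simp_rw [mul_comm]
  rw [hK, ← Matrix.mul_assoc, hcyc, ← Matrix.mul_assoc]
  exact (hρ.mul_mul_conjTranspose_same _).ptraceB

/-- The Kadison–Schwarz inequality `X² ≤ ∑ Yⱼ² ⊗ Eⱼ` for `X = ∑ Yⱼ ⊗ Eⱼ`, tested against a positive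
semidefinite matrix, where `Eⱼ = Fⱼᴴ Fⱼ` is a POVM. -/
lemma re_trace_sq_sum_kronecker_le [Fintype m] [Fintype n] [DecidableEq m]
    [DecidableEq n] [Fintype ι] {σ : Matrix (m × n) (m × n) ℂ} (hσ : σ.PosSemidef)
    (F : ι → Matrix n n ℂ) (hF : ∑ j, (F j)ᴴ * F j = 1)
    (Y : ι → Matrix m m ℂ) (hY : ∀ j, (Y j)ᴴ = Y j) :
    (σ * ((∑ j, Y j ⊗ₖ ((F j)ᴴ * F j)) * ∑ j, Y j ⊗ₖ ((F j)ᴴ * F j))).trace.re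
      ≤ ∑ j, (σ * ((Y j * Y j) ⊗ₖ ((F j)ᴴ * F j))).trace.re := by
  set X := ∑ j, Y j ⊗ₖ ((F j)ᴴ * F j) with hX
  have hXh : Xᴴ = X := by
    simp [hX, conjTranspose_sum, conjTranspose_kronecker, hY]
  set Z : ι → Matrix (m × n) (m × n) ℂ := fun j => Y j ⊗ₖ F j - (1 ⊗ₖ F j) * X with hZ
  have hF1 : ∑ j, ((1 : Matrix m m ℂ) ⊗ₖ ((F j)ᴴ * F j)) = 1 := by
    rw [← one_kronecker_one, ← hF]
    ext ⟨_, _⟩ ⟨_, _⟩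
    simp [Matrix.sum_apply, Finset.mul_sum]
  have hone : ∀ j, (Z j)ᴴ * Z j = (Y j * Y j) ⊗ₖ ((F j)ᴴ * F j)
      - (Y j ⊗ₖ ((F j)ᴴ * F j)) * X - X * (Y j ⊗ₖ ((F j)ᴴ * F j))
      + X * (1 ⊗ₖ ((F j)ᴴ * F j)) * X := by
    intro j
    simp only [hZ, conjTranspose_sub, conjTranspose_mul, conjTranspose_kronecker, hY, hXh,
      conjTranspose_one, Matrix.sub_mul, Matrix.mul_sub]
    have k1 : (Y j ⊗ₖ (F j)ᴴ) * (Y j ⊗ₖ F j) = (Y j * Y j) ⊗ₖ ((F j)ᴴ * F j) := by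
      rw [← mul_kronecker_mul]
    have k2 : (Y j ⊗ₖ (F j)ᴴ) * ((1 ⊗ₖ F j) * X) = (Y j ⊗ₖ ((F j)ᴴ * F j)) * X := by
      rw [← Matrix.mul_assoc, ← mul_kronecker_mul, Matrix.mul_one]
    have k3 : X * (1 ⊗ₖ (F j)ᴴ) * (Y j ⊗ₖ F j) = X * (Y j ⊗ₖ ((F j)ᴴ * F j)) := by
      rw [Matrix.mul_assoc, ← mul_kronecker_mul, Matrix.one_mul]
    have k4 : X * ((1 : Matrix m m ℂ) ⊗ₖ (F j)ᴴ) * ((1 ⊗ₖ F j) * X)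
        = X * (1 ⊗ₖ ((F j)ᴴ * F j)) * X := by
      rw [← Matrix.mul_assoc, Matrix.mul_assoc X, ← mul_kronecker_mul, Matrix.one_mul]
    rw [k1, k2, k3, k4]
    abel
  have hsum : ∑ j, (Z j)ᴴ * Z j = ∑ j, (Y j * Y j) ⊗ₖ ((F j)ᴴ * F j) - X * X := by
    simp_rw [hone, Finset.sum_add_distrib, Finset.sum_sub_distrib, ← Matrix.sum_mul,
      ← Matrix.mul_sum, hF1, ← hX, Matrix.mul_one]
    abel
  have hnn : 0 ≤ (∑ j, (σ * ((Z j)ᴴ * Z j)).trace).re := by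
    rw [Complex.re_sum]
    refine Finset.sum_nonneg fun j _ => ?_
    rw [← Matrix.mul_assoc, trace_mul_comm, ← Matrix.mul_assoc]
    exact (Complex.le_def.1 (hσ.mul_mul_conjTranspose_same (Z j)).trace_nonneg).1
  rw [← trace_sum, ← Matrix.mul_sum, hsum, Matrix.mul_sub, trace_sub, Matrix.mul_sum, trace_sum,
    Complex.sub_re, Complex.re_sum] at hnn
  linarith

end PartialTrace

section Measured

variable {m n ι : Type*} [Fintype m] [Fintype n] [Fintype ι] [DecidableEq m]

lemma ptraceA_one_kronecker_conj (M : Matrix (m × n) (m × n) ℂ) (A B : Matrix n n ℂ) :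
    ptraceA (((1 : Matrix m m ℂ) ⊗ₖ A) * M * ((1 : Matrix m m ℂ) ⊗ₖ B)) = A * ptraceA M * B := by
  refine Matrix.ext_iff_trace_mul_right.2 fun Z => ?_
  rw [← trace_mul_one_kronecker, Matrix.mul_assoc, ← mul_kronecker_mul, Matrix.one_mul,
    Matrix.mul_assoc, trace_mul_comm, Matrix.mul_assoc, ← mul_kronecker_mul, Matrix.one_mul,
    trace_mul_one_kronecker, Matrix.mul_assoc (A * _), Matrix.mul_assoc A, trace_mul_comm A]
  simp only [Matrix.mul_assoc]

lemma trace_mul_diagonal_mul_conjTranspose (T : Matrix m m ℂ) (hT : Tᴴ * T = 1) (d : m → ℝ) :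
    (T * diagonal (fun l => (d l : ℂ)) * Tᴴ).trace = ((∑ l, d l : ℝ) : ℂ) := by
  rw [trace_mul_comm, ← Matrix.mul_assoc, hT, Matrix.one_mul, trace_diagonal, Complex.ofReal_sum]

lemma mul_diagonal_mul_conjTranspose_mul (T : Matrix m m ℂ) (hT : Tᴴ * T = 1) (d e : m → ℝ) :
    (T * diagonal (fun l => (d l : ℂ)) * Tᴴ) * (T * diagonal (fun l => (e l : ℂ)) * Tᴴ)
      = T * diagonal (fun l => ((d l * e l : ℝ) : ℂ)) * Tᴴ := by
  have : diagonal (fun l => ((d l * e l : ℝ) : ℂ))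
      = diagonal (fun l => (d l : ℂ)) * diagonal (fun l => (e l : ℂ)) := by
    simp [diagonal_mul_diagonal]
  rw [this]
  calc _ = T * diagonal (fun l => (d l : ℂ)) * (Tᴴ * T) * diagonal (fun l => (e l : ℂ)) * Tᴴ := by
        simp only [Matrix.mul_assoc]
    _ = _ := by rw [hT]; simp only [Matrix.mul_assoc, Matrix.one_mul]

variable [DecidableEq n]

/-- Monotonicity under a measurement on `B` of the resolvents of the relative modular operator of
`1 ⊗ ρ^B` and `ρ`. -/
lemma sum_resolvent_measured_le {ρ : Matrix (m × n) (m × n) ℂ} (hρ : ρ.PosSemidef)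
    {U : Matrix (m × n) (m × n) ℂ} (hU : Uᴴ * U = 1) {lam : m × n → ℝ} (hlam : ∀ i, 0 ≤ lam i)
    (hρU : ρ = U * diagonal (fun i => (lam i : ℂ)) * Uᴴ)
    {W : Matrix n n ℂ} (hW : Wᴴ * W = 1) {mu : n → ℝ} (hmu : ∀ k, 0 ≤ mu k)
    (hρW : ptraceA ρ = W * diagonal (fun k => (mu k : ℂ)) * Wᴴ) (hB : (ptraceA ρ).PosSemidef)
    (F : ι → Matrix n n ℂ) (hF : ∑ j, (F j)ᴴ * F j = 1)
    {T : ι → Matrix m m ℂ} (hT : ∀ j, (T j)ᴴ * T j = 1) {κ : ι → m → ℝ}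
    (hR : ∀ j, ptraceB (ρ * ((1 : Matrix m m ℂ) ⊗ₖ ((F j)ᴴ * F j)))
      = T j * diagonal (fun l => (κ j l : ℂ)) * (T j)ᴴ)
    {β : ι → ℝ} (hβ : ∀ j, β j = (ptraceA ρ * ((F j)ᴴ * F j)).trace.re) {s : ℝ} (hs : 0 < s) :
    ∑ j, ∑ l, κ j l * (κ j l / (β j + s * κ j l))
      ≤ ∑ k, ∑ i, ‖(((1 : Matrix m m ℂ) ⊗ₖ W)ᴴ * U) k i‖ ^ 2 * lam i
          * (lam i / (mu k.2 + s * lam i)) := by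
  set y : ι → m → ℝ := fun j l => κ j l / (β j + s * κ j l) with hy
  set Y : ι → Matrix m m ℂ := fun j => T j * diagonal (fun l => (y j l : ℂ)) * (T j)ᴴ with hYdef
  have hY : ∀ j, (Y j)ᴴ = Y j := by
    intro j
    simp only [hYdef, conjTranspose_mul, conjTranspose_conjTranspose, diagonal_conjTranspose,
      Matrix.mul_assoc]
    congr 3
    ext l
    simp
  set X := ∑ j, Y j ⊗ₖ ((F j)ᴴ * F j) with hX
  have hXh : Xᴴ = X := by
    simp [hX, conjTranspose_sum, conjTranspose_kronecker, hY]
  have hV : ((1 : Matrix m m ℂ) ⊗ₖ W)ᴴ * (1 ⊗ₖ W) = 1 := by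
    rw [conjTranspose_kronecker, ← mul_kronecker_mul, hW]
    simp
  have hσ : (1 : Matrix m m ℂ) ⊗ₖ ptraceA ρ
      = (1 ⊗ₖ W) * diagonal (fun k : m × n => (mu k.2 : ℂ)) * (1 ⊗ₖ W)ᴴ := by
    have : diagonal (fun k : m × n => (mu k.2 : ℂ))
        = (1 : Matrix m m ℂ) ⊗ₖ diagonal (fun k => (mu k : ℂ)) := by
      rw [← diagonal_one, diagonal_kronecker_diagonal]
      simp
    rw [this, conjTranspose_kronecker, ← mul_kronecker_mul, ← mul_kronecker_mul, hρW]
    simp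
  have key := two_mul_re_trace_sub_le U ((1 : Matrix m m ℂ) ⊗ₖ W) X hU hV lam (fun k => mu k.2)
    hlam (fun k => hmu k.2) hs
  rw [← hσ, ← hρU, hXh] at key
  have htr : ∀ (Z : Matrix m m ℂ) (j : ι), (ρ * (Z ⊗ₖ ((F j)ᴴ * F j))).trace
      = (ptraceB (ρ * ((1 : Matrix m m ℂ) ⊗ₖ ((F j)ᴴ * F j))) * Z).trace := by
    intro Z j
    rw [← trace_mul_kronecker_one, Matrix.mul_assoc, ← mul_kronecker_mul, Matrix.one_mul,
      Matrix.mul_one]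
  have h1 : (X * ρ).trace.re = ∑ j, ∑ l, κ j l * y j l := by
    rw [trace_mul_comm, hX, Matrix.mul_sum, trace_sum, Complex.re_sum]
    refine Finset.sum_congr rfl fun j _ => ?_
    rw [htr, hR, hYdef, mul_diagonal_mul_conjTranspose_mul _ (hT j),
      trace_mul_diagonal_mul_conjTranspose _ (hT j), Complex.ofReal_re]
  have hYY : ∀ j, Y j * Y j = T j * diagonal (fun l => ((y j l * y j l : ℝ) : ℂ)) * (T j)ᴴ :=
    fun j => mul_diagonal_mul_conjTranspose_mul _ (hT j) _ _
  have h2 : (X * (1 ⊗ₖ ptraceA ρ) * X).trace.re ≤ ∑ j, ∑ l, β j * (y j l * y j l) := by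
    rw [trace_mul_comm, ← Matrix.mul_assoc, trace_mul_comm]
    refine (re_trace_sq_sum_kronecker_le (PosSemidef.one.kronecker hB) F hF Y hY).trans_eq ?_
    refine Finset.sum_congr rfl fun j _ => ?_
    rw [← mul_kronecker_mul, Matrix.one_mul, trace_kronecker, hYY,
      trace_mul_diagonal_mul_conjTranspose _ (hT j), Complex.re_ofReal_mul, ← hβ, mul_comm,
      Finset.mul_sum]
  have h3 : (X * ρ * X).trace.re ≤ ∑ j, ∑ l, κ j l * (y j l * y j l) := by
    rw [trace_mul_comm, ← Matrix.mul_assoc, trace_mul_comm]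
    refine (re_trace_sq_sum_kronecker_le hρ F hF Y hY).trans_eq ?_
    refine Finset.sum_congr rfl fun j _ => ?_
    rw [htr, hR, hYY, mul_diagonal_mul_conjTranspose_mul _ (hT j),
      trace_mul_diagonal_mul_conjTranspose _ (hT j), Complex.ofReal_re]
  have hsum : ∑ j, ∑ l, κ j l * (κ j l / (β j + s * κ j l))
      = 2 * ∑ j, ∑ l, κ j l * y j l - ∑ j, ∑ l, β j * (y j l * y j l)
        - s * ∑ j, ∑ l, κ j l * (y j l * y j l) := by
    simp_rw [Finset.mul_sum, ← Finset.sum_sub_distrib]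
    refine Finset.sum_congr rfl fun j _ => Finset.sum_congr rfl fun l _ => ?_
    by_cases hd : β j + s * κ j l = 0
    · simp [hy, hd]
    · have hk : y j l * (β j + s * κ j l) = κ j l := div_mul_cancel₀ _ hd
      change κ j l * y j l = _
      linear_combination y j l * hk
  have h3' := mul_le_mul_of_nonneg_left h3 hs.le
  rw [hsum]
  linarith

/-- Monotonicity under a measurement on `B` of the relative entropy of `ρ` to `1 ⊗ ρ^B`, in terms of
the spectra `lam` of `ρ`, `mu` of `ρ^B` and `κ j` of the unnormalised conditional states. -/
lemma sum_mul_log_measured_le {ρ : Matrix (m × n) (m × n) ℂ} (hρ : ρ.PosSemidef)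
    {U : Matrix (m × n) (m × n) ℂ} (hU : Uᴴ * U = 1) {lam : m × n → ℝ} (hlam : ∀ i, 0 ≤ lam i)
    (hρU : ρ = U * diagonal (fun i => (lam i : ℂ)) * Uᴴ)
    {W : Matrix n n ℂ} (hW : Wᴴ * W = 1) {mu : n → ℝ} (hmu : ∀ k, 0 ≤ mu k)
    (hρW : ptraceA ρ = W * diagonal (fun k => (mu k : ℂ)) * Wᴴ) (hB : (ptraceA ρ).PosSemidef)
    (F : ι → Matrix n n ℂ) (hF : ∑ j, (F j)ᴴ * F j = 1)
    {T : ι → Matrix m m ℂ} (hT : ∀ j, (T j)ᴴ * T j = 1) {κ : ι → m → ℝ}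
    (hκ : ∀ j l, 0 ≤ κ j l)
    (hR : ∀ j, ptraceB (ρ * ((1 : Matrix m m ℂ) ⊗ₖ ((F j)ᴴ * F j)))
      = T j * diagonal (fun l => (κ j l : ℂ)) * (T j)ᴴ)
    {β : ι → ℝ} (hβ : ∀ j, β j = (ptraceA ρ * ((F j)ᴴ * F j)).trace.re)
    (hβκ : ∀ j, ∑ l, κ j l = β j) :
    ∑ k, mu k * Real.log (mu k) - ∑ j, β j * Real.log (β j)
      ≤ ∑ i, lam i * Real.log (lam i) - ∑ j, ∑ l, κ j l * Real.log (κ j l) := by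
  set C := ((1 : Matrix m m ℂ) ⊗ₖ W)ᴴ * U with hC
  have hV : ((1 : Matrix m m ℂ) ⊗ₖ W)ᴴ * (1 ⊗ₖ W) = 1 := by
    rw [conjTranspose_kronecker, ← mul_kronecker_mul, hW]
    simp
  have hcol : ∀ i, ∑ k, ‖C k i‖ ^ 2 = 1 := by
    intro i
    have hCC : Cᴴ * C = 1 := by
      rw [hC, conjTranspose_mul, conjTranspose_conjTranspose]
      calc _ = Uᴴ * (((1 : Matrix m m ℂ) ⊗ₖ W) * (1 ⊗ₖ W)ᴴ) * U := by
            simp only [Matrix.mul_assoc]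
        _ = 1 := by rw [mul_eq_one_comm.mp hV, Matrix.mul_one, hU]
    have := congrArg Complex.re (congrFun (congrFun hCC i) i)
    rw [mul_apply, Complex.re_sum, one_apply_eq, Complex.one_re] at this
    rw [← this]
    refine Finset.sum_congr rfl fun k _ => ?_
    rw [conjTranspose_apply, RCLike.star_def, ← Complex.normSq_eq_conj_mul_self,
      Complex.ofReal_re, Complex.normSq_eq_norm_sq]
  have hrow : ∀ k, ∑ x, ∑ i, ‖C (x, k) i‖ ^ 2 * lam i = mu k := by
    intro k
    have hM : ptraceA (C * diagonal (fun i => (lam i : ℂ)) * Cᴴ)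
        = diagonal (fun k => (mu k : ℂ)) := by
      have : C * diagonal (fun i => (lam i : ℂ)) * Cᴴ
          = ((1 : Matrix m m ℂ) ⊗ₖ Wᴴ) * ρ * (1 ⊗ₖ W) := by
        rw [hρU, hC, conjTranspose_mul, conjTranspose_conjTranspose, conjTranspose_kronecker,
          conjTranspose_one]
        simp only [Matrix.mul_assoc]
      rw [this, ptraceA_one_kronecker_conj, hρW]
      calc _ = (Wᴴ * W) * diagonal (fun k => (mu k : ℂ)) * (Wᴴ * W) := by
            simp only [Matrix.mul_assoc]
        _ = _ := by rw [hW, Matrix.one_mul, Matrix.mul_one]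
    have := congrArg Complex.re (congrFun (congrFun hM k) k)
    rw [diagonal_apply_eq, Complex.ofReal_re, ptraceA, Complex.re_sum] at this
    rw [← this]
    refine Finset.sum_congr rfl fun x _ => ?_
    rw [mul_apply, Complex.re_sum]
    refine Finset.sum_congr rfl fun i _ => ?_
    rw [mul_diagonal, conjTranspose_apply, mul_right_comm, RCLike.star_def, Complex.mul_conj,
      ← Complex.ofReal_mul, Complex.ofReal_re, Complex.normSq_eq_norm_sq]
  have hcolf : ∀ f : m × n → ℝ,
      ∑ k, ∑ i, ‖C k i‖ ^ 2 * lam i * f i = ∑ i, lam i * f i := by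
    intro f
    rw [Finset.sum_comm]
    refine Finset.sum_congr rfl fun i _ => ?_
    simp_rw [mul_assoc]
    rw [← Finset.sum_mul, hcol, one_mul]
  have hrowf : ∀ f : n → ℝ,
      ∑ k : m × n, ∑ i, ‖C k i‖ ^ 2 * lam i * f k.2 = ∑ k, mu k * f k := by
    intro f
    rw [Fintype.sum_prod_type, Finset.sum_comm]
    refine Finset.sum_congr rfl fun k _ => ?_
    simp_rw [← Finset.sum_mul]
    rw [hrow]
  have hw : ∀ k i, 0 ≤ ‖C k i‖ ^ 2 * lam i := fun k i => mul_nonneg (sq_nonneg _) (hlam i)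
  have hβ0 : ∀ j, 0 ≤ β j := fun j => hβκ j ▸ Finset.sum_nonneg fun l _ => hκ j l
  have hκβ : ∑ j, ∑ l, κ j l = ∑ i, lam i := by
    have hlamtr : ρ.trace.re = ∑ i, lam i := by
      rw [hρU, trace_mul_diagonal_mul_conjTranspose _ hU, Complex.ofReal_re]
    have hone : (1 : Matrix m m ℂ) ⊗ₖ (1 : Matrix n n ℂ) = 1 := one_kronecker_one
    simp_rw [hβκ, hβ]
    rw [← Complex.re_sum, ← trace_sum, ← Matrix.mul_sum, hF, ← trace_mul_one_kronecker, hone,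
      Matrix.mul_one, hlamtr]
  have key := sum_mul_log_le_of_resolvent_nonneg
    (ι := ((m × n) × (m × n)) ⊕ (ι × m))
    (Sum.elim (fun x => ‖C x.1 x.2‖ ^ 2 * lam x.2) (fun x => -κ x.1 x.2))
    (Sum.elim (fun x => mu x.1.2) (fun x => β x.1))
    (Sum.elim (fun x => lam x.2) (fun x => κ x.1 x.2)) ?_ ?_ ?_ ?_
  · simp only [Fintype.sum_sum_type, Sum.elim_inl, Sum.elim_inr,
      Fintype.sum_prod_type (f := fun x : (m × n) × (m × n) => _),
      Fintype.sum_prod_type (f := fun x : ι × m => _), neg_mul, Finset.sum_neg_distrib] at key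
    rw [hcolf fun i => Real.log (lam i), hrowf fun k => Real.log (mu k)] at key
    simp_rw [← Finset.sum_mul, hβκ] at key
    linarith
  · rintro (⟨⟨x, k⟩, i⟩ | ⟨j, l⟩) h
    · refine (hmu k).lt_of_ne fun h0 => h ?_
      have h1 := hrow k
      rw [← h0, Finset.sum_eq_zero_iff_of_nonneg
        fun x _ => Finset.sum_nonneg fun i _ => hw (x, k) i] at h1
      exact (Finset.sum_eq_zero_iff_of_nonneg fun i _ => hw (x, k) i).1
        (h1 x (Finset.mem_univ _)) i (Finset.mem_univ _)
    · refine (hβ0 j).lt_of_ne fun h0 => h ?_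
      have h1 := hβκ j
      rw [← h0, Finset.sum_eq_zero_iff_of_nonneg fun l _ => hκ j l] at h1
      simpa using h1 l (Finset.mem_univ _)
  · rintro (⟨k, i⟩ | ⟨j, l⟩) h
    · exact (hlam i).lt_of_ne fun h0 => h (by simp [← h0])
    · exact (hκ j l).lt_of_ne fun h0 => h (by simp [← h0])
  · have h1 := hcolf fun _ => 1
    simp only [mul_one] at h1
    simp only [Fintype.sum_sum_type, Sum.elim_inl, Sum.elim_inr,
      Fintype.sum_prod_type (f := fun x : (m × n) × (m × n) => _),
      Fintype.sum_prod_type (f := fun x : ι × m => _), Finset.sum_neg_distrib]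
    linarith
  · intro s hs
    have h1 := sum_resolvent_measured_le hρ hU hlam hρU hW hmu hρW hB F hF hT hR hβ hs
    simp only [Fintype.sum_sum_type, Sum.elim_inl, Sum.elim_inr,
      Fintype.sum_prod_type (f := fun x : (m × n) × (m × n) => _),
      Fintype.sum_prod_type (f := fun x : ι × m => _), neg_mul, Finset.sum_neg_distrib]
    linarith

end Measured

lemma Matrix.PosSemidef.ptraceA {m n : Type*} [Fintype m] {M : Matrix (m × n) (m × n) ℂ}
    (hM : M.PosSemidef) : (ptraceA M).PosSemidef := by
  have : _root_.ptraceA M = ∑ i, M.submatrix (fun j => (i, j)) (fun j => (i, j)) := by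
    ext j j'
    simp [_root_.ptraceA, Matrix.sum_apply]
  rw [this]
  exact posSemidef_sum _ fun i _ => hM.submatrix _

lemma vNEntropy_eq_neg_sum_div {d : Type*} [Fintype d] [DecidableEq d] {ρ : Matrix d d ℂ}
    (h : ρ.IsHermitian) :
    vNEntropy h = -(∑ i, h.eigenvalues i * Real.log (h.eigenvalues i)) / Real.log 2 := by
  simp [vNEntropy, Real.logb, mul_div_assoc, Finset.sum_div, neg_div]

lemma conjTranspose_eigenvectorUnitary_mul_self {n : Type*} [Fintype n] [DecidableEq n]
    {A : Matrix n n ℂ} (hA : A.IsHermitian) :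
    (hA.eigenvectorUnitary : Matrix n n ℂ)ᴴ * (hA.eigenvectorUnitary : Matrix n n ℂ) = 1 :=
  Unitary.coe_star_mul_self hA.eigenvectorUnitary

/-- nonnegativity of quantum discord: for any bipartite density
matrix `ρ^{AB}` and any POVM `{F_j† F_j}` on `B` (so the discord
`D(A⟩B) = S(A:B)_ρ − sup_{POVM} [S(ρ^A) − Σ_j β_j S(ρ^A_j)]` is nonnegative),
the classical-correlation term is bounded by the quantum mutual information:
`S(ρ^A) − Σ_j β_j S(ρ^A_j) ≤ S(ρ^A) + S(ρ^B) − S(ρ^{AB})`, where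
`β_j = Tr(ρ^{AB}(I ⊗ F_j† F_j))` and `ρ^A_j = Tr_B(ρ^{AB}(I ⊗ F_j† F_j))/β_j`. -/
theorem quantum_discord_nonneg
    {a b m : ℕ}
    (ρ : Matrix (Fin a × Fin b) (Fin a × Fin b) ℂ)
    (hρ : ρ.PosSemidef) (htr : ρ.trace = 1)
    (hA : (ptraceB ρ).IsHermitian) (hB : (ptraceA ρ).IsHermitian)
    (F : Fin m → Matrix (Fin b) (Fin b) ℂ)
    (hF : ∑ j, (F j)ᴴ * F j = 1)
    (β : Fin m → ℝ)
    (hβ : ∀ j, β j = ((ρ * ((1 : Matrix (Fin a) (Fin a) ℂ) ⊗ₖ ((F j)ᴴ * F j))).trace).re)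
    (ρA : Fin m → Matrix (Fin a) (Fin a) ℂ)
    (hρA : ∀ j, ρA j = ((β j)⁻¹ : ℂ) •
        ptraceB (ρ * ((1 : Matrix (Fin a) (Fin a) ℂ) ⊗ₖ ((F j)ᴴ * F j))))
    (hρAh : ∀ j, (ρA j).IsHermitian) :
    vNEntropy hA - ∑ j, β j * vNEntropy (hρAh j)
      ≤ vNEntropy hA + vNEntropy hB - vNEntropy hρ.1 := by
  have hBp : (ptraceA ρ).PosSemidef := hρ.ptraceA
  have hβ' : ∀ j, β j = (ptraceA ρ * ((F j)ᴴ * F j)).trace.re := fun j => by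
    rw [hβ, trace_mul_one_kronecker]
  set R : Fin m → Matrix (Fin a) (Fin a) ℂ := fun j =>
    ptraceB (ρ * ((1 : Matrix (Fin a) (Fin a) ℂ) ⊗ₖ ((F j)ᴴ * F j))) with hRdef
  have hRp : ∀ j, (R j).PosSemidef := fun j => posSemidef_ptraceB_mul_one_kronecker hρ (F j)
  have hRtr : ∀ j, (R j).trace = β j := by
    intro j
    have h0 := Complex.le_def.1 (hRp j).trace_nonneg
    apply Complex.ext
    · rw [hβ, Complex.ofReal_re, hRdef, trace_ptraceB]
    · simpa using h0.2.symm
  have hβ0 : ∀ j, 0 ≤ β j := fun j => by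
    have := (hRp j).trace_nonneg
    rw [hRtr] at this
    exact_mod_cast this
  have hRρ : ∀ j, R j = (β j : ℂ) • ρA j := by
    intro j
    rw [hρA]
    by_cases hz : β j = 0
    · rw [hz, Complex.ofReal_zero, zero_smul]
      exact (hRp j).trace_eq_zero_iff.1 (by rw [hRtr, hz, Complex.ofReal_zero])
    · rw [smul_smul, mul_inv_cancel₀ (by exact_mod_cast hz), one_smul]
  have hρAp : ∀ j, (ρA j).PosSemidef := by
    intro j
    rw [hρA]
    have hinv : (0 : ℂ) ≤ (β j : ℂ)⁻¹ := by
      rw [← Complex.ofReal_inv]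
      exact_mod_cast inv_nonneg.2 (hβ0 j)
    exact PosSemidef.smul (hRp j) hinv
  have he1 : ∀ j, β j * ∑ l, (hρAh j).eigenvalues l = β j := by
    intro j
    have h1 := congrArg Complex.re (hRtr j)
    rw [hRρ, trace_smul, (hρAh j).trace_eq_sum_eigenvalues, smul_eq_mul, Complex.re_ofReal_mul,
      Complex.re_sum, Complex.ofReal_re] at h1
    exact h1
  have hκR : ∀ j, R j = ((hρAh j).eigenvectorUnitary : Matrix (Fin a) (Fin a) ℂ)
      * diagonal (fun l => ((β j * (hρAh j).eigenvalues l : ℝ) : ℂ))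
      * ((hρAh j).eigenvectorUnitary : Matrix (Fin a) (Fin a) ℂ)ᴴ := by
    intro j
    rw [hRρ]
    conv_lhs => rw [(hρAh j).eq_eigenvectorUnitary_mul_diagonal]
    rw [← Matrix.smul_mul, ← Matrix.mul_smul, ← diagonal_smul]
    congr 3
    ext l
    simp
  have hκ0 : ∀ j l, 0 ≤ β j * (hρAh j).eigenvalues l :=
    fun j l => mul_nonneg (hβ0 j) ((hρAp j).eigenvalues_nonneg l)
  have hβκ : ∀ j, ∑ l, β j * (hρAh j).eigenvalues l = β j := fun j => by
    rw [← Finset.mul_sum, he1]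
  have key := sum_mul_log_measured_le hρ (conjTranspose_eigenvectorUnitary_mul_self hρ.1)
    hρ.eigenvalues_nonneg hρ.1.eq_eigenvectorUnitary_mul_diagonal
    (conjTranspose_eigenvectorUnitary_mul_self hB) hBp.eigenvalues_nonneg
    hB.eq_eigenvectorUnitary_mul_diagonal hBp F hF
    (fun j => conjTranspose_eigenvectorUnitary_mul_self (hρAh j)) hκ0 hκR hβ' hβκ
  have hsplit : ∀ j, ∑ l, β j * (hρAh j).eigenvalues l
        * Real.log (β j * (hρAh j).eigenvalues l)
      = β j * Real.log (β j)
        + β j * ∑ l, (hρAh j).eigenvalues l * Real.log ((hρAh j).eigenvalues l) := by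
    intro j
    by_cases hz : β j = 0
    · simp [hz]
    rw [← he1 j, mul_assoc, Finset.sum_mul, he1 j, ← mul_add, ← Finset.sum_add_distrib,
      Finset.mul_sum]
    refine Finset.sum_congr rfl fun l _ => ?_
    by_cases hl : (hρAh j).eigenvalues l = 0
    · simp [hl]
    · rw [Real.log_mul hz hl]
      ring
  simp_rw [hsplit, Finset.sum_add_distrib] at key
  simp_rw [vNEntropy_eq_neg_sum_div, mul_div_assoc', ← Finset.sum_div, mul_neg,
    Finset.sum_neg_distrib]
  have hlog : 0 < Real.log 2 := Real.log_pos one_lt_two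
  rw [add_sub_assoc, sub_eq_add_neg, add_le_add_iff_left, ← neg_div, neg_neg, ← sub_div]
  gcongr
  linarith
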